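/- arXiv:2008.08295 — 4 statements merged into one kernel-verified Lean document; each statement's English description precedes it below -/
import Mathlib

section
/- Let U : ℝ^d → ℝ be C², a Morse function, satisfying the growth conditions. Let h = min_{ℝ^d} U and let M⋆ = {x : U(x) = h} be the (finite, nonempty) set of global minima of U, each of which is a nondegenerate critical point with positive definite Hessian. Then lim_{ε→0⁺} Z_ε · e^{h/ε} · (2πε)^{−d/2} = ν⋆, where Z_ε = ∫_{ℝ^d} e^{−U(x)/ε} dx and ν⋆ = Σ_{m∈M⋆} (det ∇²U(m))^{−1/2}. -/
open Real MeasureTheory Set Filter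
open scoped InnerProductSpace BigOperators Topology ENNReal

noncomputable section

/-- `ℝ^d` with the Euclidean structure. -/
abbrev Euc (d : ℕ) := EuclideanSpace ℝ (Fin d)

/-- The Laplacian `Δ f`. -/
def lap {d : ℕ} (f : Euc d → ℝ) (x : Euc d) : ℝ :=
  ∑ i, fderiv ℝ (fun y => fderiv ℝ f y (EuclideanSpace.single i 1)) x (EuclideanSpace.single i 1)

/-- The divergence `∇ · F` of a vector field. -/
def vdiv {d : ℕ} (F : Euc d → Euc d) (x : Euc d) : ℝ :=
  ∑ i, fderiv ℝ (fun y => F y i) x (EuclideanSpace.single i 1)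

/-- The growth conditions (1.5) on the potential `U`. -/
def GrowthConditions {d : ℕ} (U : Euc d → ℝ) : Prop :=
  (∀ C : ℝ, ∃ R : ℝ, ∀ x : Euc d, R ≤ ‖x‖ → C ≤ U x / ‖x‖) ∧
  (∀ C : ℝ, ∃ R : ℝ, ∀ x : Euc d, R ≤ ‖x‖ → C ≤ ⟪x, gradient U x⟫_ℝ / ‖x‖) ∧
  (∀ C : ℝ, ∃ R : ℝ, ∀ x : Euc d, R ≤ ‖x‖ → C ≤ ‖gradient U x‖ - 2 * lap U x)

/-- `U` is a Morse function: every critical point is nondegenerate, i.e. the Hessian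
(the derivative of the gradient field) is invertible there. -/
def IsMorse {d : ℕ} (U : Euc d → ℝ) : Prop :=
  ∀ x, gradient U x = 0 → Function.Bijective (fderiv ℝ (gradient U) x)

/-- Determinant of the Hessian `∇²U(m)`. -/
def detHess {d : ℕ} (U : Euc d → ℝ) (m : Euc d) : ℝ :=
  LinearMap.det (fderiv ℝ (gradient U) m).toLinearMap

/-- The generator `𝓛_ε f = -(∇U + ℓ)·∇f + ε Δf`. -/
def gen {d : ℕ} (U : Euc d → ℝ) (ℓ : Euc d → Euc d) (ε : ℝ) (f : Euc d → ℝ) (x : Euc d) : ℝ :=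
  - ⟪gradient U x + ℓ x, gradient f x⟫_ℝ + ε * lap f x

/-- The Gibbs measure `μ_ε(dx) = Z_ε⁻¹ e^{-U(x)/ε} dx`. -/
def gibbs {d : ℕ} (U : Euc d → ℝ) (ε : ℝ) : Measure (Euc d) :=
  (ENNReal.ofReal (∫ x : Euc d, Real.exp (-U x / ε)))⁻¹ •
    (volume.withDensity fun x => ENNReal.ofReal (Real.exp (-U x / ε)))

/-- A positive operator factors as `S† ∘ S`. -/
lemma LinearMap.IsPositive.exists_inner_eq_norm_sq {d : ℕ} {T : Euc d →ₗ[ℝ] Euc d}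
    (hT : T.IsPositive) :
    ∃ S : Euc d →ₗ[ℝ] Euc d, (∀ v, ⟪v, T v⟫_ℝ = ‖S v‖ ^ 2) ∧
      LinearMap.det T = LinearMap.det S ^ 2 := by
  let b := EuclideanSpace.basisFun (Fin d) ℝ
  have hM := (LinearMap.posSemidef_toMatrix_iff b).2 hT
  obtain ⟨B, hB⟩ : ∃ B : Matrix (Fin d) (Fin d) ℝ,
      LinearMap.toMatrix b.toBasis b.toBasis T = star B * B := by
    open scoped MatrixOrder in
    exact CStarAlgebra.nonneg_iff_eq_star_mul_self.1 hM.nonneg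
  let S := Matrix.toLin b.toBasis b.toBasis B
  have hTS : T = LinearMap.adjoint S ∘ₗ S := by
    rw [← Matrix.toLin_conjTranspose, ← Matrix.toLin_mul, ← Matrix.star_eq_conjTranspose, ← hB,
      Matrix.toLin_toMatrix]
  refine ⟨S, fun v => ?_, ?_⟩
  · rw [hTS, LinearMap.comp_apply, LinearMap.adjoint_inner_right, real_inner_self_eq_norm_sq]
  · rw [← LinearMap.det_toMatrix b.toBasis, hB, Matrix.det_mul, LinearMap.det_toLin,
      Matrix.star_eq_conjTranspose, Matrix.det_conjTranspose, star_trivial, sq]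

/-- The Gaussian integral of a symmetric positive definite quadratic form. -/
lemma integral_exp_neg_half_inner {d : ℕ} {T : Euc d →ₗ[ℝ] Euc d} (hT : T.IsSymmetric)
    (hpos : ∀ v, v ≠ 0 → 0 < ⟪v, T v⟫_ℝ) :
    ∫ v : Euc d, rexp (-(⟪v, T v⟫_ℝ / 2)) = (2 * π) ^ ((d : ℝ) / 2) / √(LinearMap.det T) := by
  have hT' : T.IsPositive := by
    refine ⟨hT, fun v => ?_⟩
    rcases eq_or_ne v 0 with rfl | hv
    · simp
    · simpa [real_inner_comm] using (hpos v hv).le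
  obtain ⟨S, hS, hdet⟩ := hT'.exists_inner_eq_norm_sq
  have hinj : Function.Injective S := by
    rw [injective_iff_map_eq_zero]
    intro v hv
    by_contra hne
    have := hpos v hne
    simp [hS, hv] at this
  have hS0 : LinearMap.det S ≠ 0 := by
    intro h0
    exact (LinearMap.bot_lt_ker_of_det_eq_zero h0).ne' (LinearMap.ker_eq_bot.2 hinj)
  have hmap := Measure.map_linearMap_addHaar_eq_smul_addHaar (volume : Measure (Euc d)) hS0
  have hemb : MeasurableEmbedding S :=
    (LinearMap.isClosedEmbedding_of_injective (LinearMap.ker_eq_bot.2 hinj)).measurableEmbedding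
  calc ∫ v : Euc d, rexp (-(⟪v, T v⟫_ℝ / 2))
      = ∫ v : Euc d, rexp (-(1 / 2) * ‖S v‖ ^ 2) := by
        refine integral_congr_ae (.of_forall fun v => ?_)
        simp only [hS]
        ring_nf
    _ = ∫ w, rexp (-(1 / 2) * ‖w‖ ^ 2) ∂(Measure.map S volume) :=
        (hemb.integral_map fun w => rexp (-(1 / 2) * ‖w‖ ^ 2)).symm
    _ = _ := by
        rw [hmap, integral_smul_measure,
          GaussianFourier.integral_rexp_neg_mul_sq_norm (by norm_num : (0 : ℝ) < 1 / 2), hdet,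
          Real.sqrt_sq_eq_abs, ENNReal.toReal_ofReal (abs_nonneg _), abs_inv, smul_eq_mul,
          finrank_euclideanSpace_fin, div_eq_inv_mul _ |LinearMap.det S|]
        congr 3
        ring

lemma integrable_exp_neg_mul_norm_sq {d : ℕ} {c : ℝ} (hc : 0 < c) :
    Integrable fun v : Euc d => rexp (-c * ‖v‖ ^ 2) := by
  by_contra hInt
  have := GaussianFourier.integral_rexp_neg_mul_sq_norm (V := Euc d) hc
  rw [integral_undef hInt] at this
  have : 0 < (π / c) ^ (Module.finrank ℝ (Euc d) / 2 : ℝ) := by positivity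
  linarith

/-- A positive definite quadratic form is coercive. -/
lemma exists_pos_mul_norm_sq_le_inner {d : ℕ} {T : Euc d →L[ℝ] Euc d}
    (hpos : ∀ v, v ≠ 0 → 0 < ⟪v, T v⟫_ℝ) : ∃ c > 0, ∀ v, c * ‖v‖ ^ 2 ≤ ⟪v, T v⟫_ℝ := by
  rcases (Metric.sphere (0 : Euc d) 1).eq_empty_or_nonempty with he | hne
  · refine ⟨1, one_pos, fun v => ?_⟩
    rcases eq_or_ne v 0 with rfl | hv
    · simp
    · exact absurd (show (‖v‖⁻¹ • v) ∈ Metric.sphere (0 : Euc d) 1 by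
        simp [norm_smul, hv]) (by simp [he])
  · obtain ⟨w, hw, hwmin⟩ := (isCompact_sphere (0 : Euc d) 1).exists_isMinOn hne
      (f := fun v => ⟪v, T v⟫_ℝ) (by fun_prop)
    refine ⟨⟪w, T w⟫_ℝ, hpos w (by rintro rfl; simp at hw), fun v => ?_⟩
    rcases eq_or_ne v 0 with rfl | hv
    · simp
    have hv' : 0 < ‖v‖ := norm_pos_iff.2 hv
    have := hwmin (show (‖v‖⁻¹ • v) ∈ Metric.sphere (0 : Euc d) 1 by simp [norm_smul, hv])
    simp only [Set.mem_ofPred_eq, map_smul, inner_smul_left, inner_smul_right, conj_trivial] at this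
    calc _ ≤ (‖v‖⁻¹ * (‖v‖⁻¹ * ⟪v, T v⟫_ℝ)) * ‖v‖ ^ 2 := by gcongr
      _ = _ := by field_simp

lemma ContDiff.contDiff_gradient {d : ℕ} {U : Euc d → ℝ} (hU : ContDiff ℝ 2 U) :
    ContDiff ℝ 1 (gradient U) :=
  (InnerProductSpace.toDual ℝ (Euc d)).symm.contDiff.comp
    (hU.fderiv_right (m := 1) (by norm_num))

/-- The Hessian of a `C²` function is symmetric. -/
lemma ContDiff.isSymmetric_fderiv_gradient {d : ℕ} {U : Euc d → ℝ} (hU : ContDiff ℝ 2 U)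
    (m : Euc d) : (fderiv ℝ (gradient U) m).toLinearMap.IsSymmetric := by
  have hsym : IsSymmSndFDerivAt ℝ U m := hU.contDiffAt.isSymmSndFDerivAt (by simp)
  have hd : DifferentiableAt ℝ (gradient U) m :=
    hU.contDiff_gradient.differentiable (by norm_num) m
  have key : ∀ v w, ⟪fderiv ℝ (gradient U) m v, w⟫_ℝ = fderiv ℝ (fderiv ℝ U) m v w := by
    intro v w
    have h2 := ((InnerProductSpace.toDual ℝ (Euc d)).toContinuousLinearEquiv.hasFDerivAt.comp m
      hd.hasFDerivAt).fderiv
    have h3 : (InnerProductSpace.toDual ℝ (Euc d)).toContinuousLinearEquiv ∘ gradient U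
      = fderiv ℝ U := toDual_comp_gradient
    rw [h3] at h2
    rw [h2]
    simp
  intro v w
  change ⟪fderiv ℝ (gradient U) m v, w⟫_ℝ = ⟪v, fderiv ℝ (gradient U) m w⟫_ℝ
  rw [key, real_inner_comm, key]
  exact hsym v w

/-- Second order Taylor expansion at a critical point. -/
lemma ContDiff.isLittleO_sub_half_inner {d : ℕ} {U : Euc d → ℝ} (hU : ContDiff ℝ 2 U)
    {m : Euc d} (hm : gradient U m = 0) :
    (fun x => U x - U m - ⟪x - m, fderiv ℝ (gradient U) m (x - m)⟫_ℝ / 2)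
      =o[𝓝 m] fun x => ‖x - m‖ ^ 2 := by
  set H := fderiv ℝ (gradient U) m with hH
  have hd : DifferentiableAt ℝ (gradient U) m :=
    hU.contDiff_gradient.differentiable (by norm_num) m
  have hlo := hd.hasFDerivAt.isLittleO
  rw [Asymptotics.isLittleO_iff] at hlo ⊢
  intro c hc
  obtain ⟨r, hr, hball⟩ := Metric.eventually_nhds_iff_ball.1 (hlo hc)
  filter_upwards [Metric.ball_mem_nhds m hr] with x hx
  let f' : Euc d → Euc d →L[ℝ] ℝ := fun y =>
    InnerProductSpace.toDual ℝ (Euc d) (gradient U y - H (y - m))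
  have hsub : Metric.closedBall m ‖x - m‖ ⊆ Metric.ball m r := by
    rw [mem_ball_iff_norm] at hx
    exact Metric.closedBall_subset_ball hx
  have hderiv : ∀ y ∈ Metric.closedBall m ‖x - m‖, HasFDerivWithinAt
      (fun x => U x - U m - ⟪x - m, H (x - m)⟫_ℝ / 2) (f' y) (Metric.closedBall m ‖x - m‖) y := by
    intro y _
    have h1 : HasFDerivAt U (fderiv ℝ U y) y := (hU.differentiable (by norm_num) y).hasFDerivAt
    have h2 : HasFDerivAt (fun x => x - m) (ContinuousLinearMap.id ℝ (Euc d)) y :=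
      (hasFDerivAt_id y).sub_const m
    have h3 := (h1.sub_const (U m)).sub
      ((h2.inner ℝ (H.hasFDerivAt.comp y h2)).mul_const (1 / 2 : ℝ))
    have h4 : HasFDerivAt (fun x => U x - U m - ⟪x - m, H (x - m)⟫_ℝ / 2) (f' y) y := by
      refine (h3.congr_fderiv ?_).congr_of_eventuallyEq
        (.of_forall fun z => by simp [div_eq_mul_inv])
      ext v
      have hs : ⟪H v, y - m⟫_ℝ = ⟪v, H (y - m)⟫_ℝ := hU.isSymmetric_fderiv_gradient m v (y - m)
      have hs' : ⟪y - m, H v⟫_ℝ = ⟪v, H (y - m)⟫_ℝ := by rw [real_inner_comm, hs]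
      have hs'' : ⟪H (y - m), v⟫_ℝ = ⟪v, H (y - m)⟫_ℝ := real_inner_comm _ _
      simp [f', -map_sub, inner_sub_left, inner_gradient_left, hs', hs'']
      ring
    exact h4.hasFDerivWithinAt
  have hbound : ∀ y ∈ Metric.closedBall m ‖x - m‖, ‖f' y‖ ≤ c * ‖x - m‖ := by
    intro y hy
    have := hball y (hsub hy)
    rw [hm, sub_zero] at this
    simp only [f', LinearIsometryEquiv.norm_map]
    refine this.trans ?_
    gcongr
    exact mem_closedBall_iff_norm.1 hy
  have := (convex_closedBall m ‖x - m‖).norm_image_sub_le_of_norm_hasFDerivWithin_le hderiv hbound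
    (Metric.mem_closedBall_self (norm_nonneg _)) (mem_closedBall_iff_norm.2 le_rfl)
  simpa [sq, mul_assoc] using this

/-- Laplace's method on a small ball around a nondegenerate local minimum. -/
lemma ContDiff.eventually_tendsto_laplace_ball {d : ℕ} {U : Euc d → ℝ} (hU : ContDiff ℝ 2 U)
    {m : Euc d} (hm : gradient U m = 0)
    (hpos : ∀ v : Euc d, v ≠ 0 → 0 < ⟪v, fderiv ℝ (gradient U) m v⟫_ℝ) :
    ∀ᶠ r in 𝓝[>] (0 : ℝ), Tendsto
      (fun ε : ℝ => ε ^ (-(d : ℝ) / 2) * ∫ x in Metric.ball m r, rexp (-((U x - U m) / ε)))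
      (𝓝[>] 0) (𝓝 ((2 * π) ^ ((d : ℝ) / 2) / √(detHess U m))) := by
  set H := fderiv ℝ (gradient U) m with hH
  obtain ⟨c, hc, hcoer⟩ := exists_pos_mul_norm_sq_le_inner hpos
  have htaylor := hU.isLittleO_sub_half_inner hm
  rw [← hH] at htaylor
  obtain ⟨r₀, hr₀, hball⟩ := Metric.eventually_nhds_iff_ball.1
    ((Asymptotics.isLittleO_iff.1 htaylor) (show 0 < c / 4 by positivity))
  have hlower : ∀ x ∈ Metric.ball m r₀, c / 4 * ‖x - m‖ ^ 2 ≤ U x - U m := by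
    intro x hx
    have h1 := hball x hx
    have h2 := hcoer (x - m)
    rw [Real.norm_eq_abs, Real.norm_eq_abs, abs_of_nonneg (sq_nonneg ‖x - m‖)] at h1
    have h3 := (abs_le.1 h1).1
    linarith
  filter_upwards [Ioo_mem_nhdsGT hr₀] with r hr
  let F : ℝ → Euc d → ℝ := fun ε y =>
    (Metric.ball m r).indicator (fun x => rexp (-((U x - U m) / ε))) (m + √ε • y)
  have hscale : (fun ε : ℝ => ∫ y, F ε y) =ᶠ[𝓝[>] 0] fun ε : ℝ =>
      ε ^ (-(d : ℝ) / 2) * ∫ x in Metric.ball m r, rexp (-((U x - U m) / ε)) := by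
    filter_upwards [self_mem_nhdsWithin] with ε (hε : 0 < ε)
    have hpow : |((√ε) ^ d)⁻¹| = ε ^ (-(d : ℝ) / 2) := by
      rw [abs_of_nonneg (by positivity), ← Real.rpow_natCast, Real.sqrt_eq_rpow,
        ← Real.rpow_mul hε.le, ← Real.rpow_neg hε.le]
      ring_nf
    rw [Measure.integral_comp_smul volume (fun y => (Metric.ball m r).indicator
      (fun x => rexp (-((U x - U m) / ε))) (m + y)) (√ε), finrank_euclideanSpace_fin, hpow,
      integral_add_left_eq_self, integral_indicator Metric.isOpen_ball.measurableSet, smul_eq_mul]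
  refine Tendsto.congr' hscale ?_
  rw [detHess, ← hH, ← integral_exp_neg_half_inner (hU.isSymmetric_fderiv_gradient m) hpos]
  refine tendsto_integral_filter_of_dominated_convergence
    (fun y => rexp (-(c / 4) * ‖y‖ ^ 2)) ?_ ?_ (integrable_exp_neg_mul_norm_sq (by positivity)) ?_
  · refine .of_forall fun ε => Measurable.aestronglyMeasurable ?_
    have hUm : Measurable U := hU.continuous.measurable
    refine Measurable.comp (g := (Metric.ball m r).indicator fun x => rexp (-((U x - U m) / ε)))
      (.indicator (by fun_prop) Metric.isOpen_ball.measurableSet) (by fun_prop)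
  · filter_upwards [self_mem_nhdsWithin] with ε (hε : 0 < ε)
    refine .of_forall fun y => ?_
    simp only [F]
    by_cases hy : m + √ε • y ∈ Metric.ball m r
    · have h1 := hlower _ (Metric.ball_subset_ball hr.2.le hy)
      rw [add_sub_cancel_left, norm_smul, mul_pow, Real.norm_eq_abs, sq_abs,
        Real.sq_sqrt hε.le] at h1
      rw [indicator_of_mem hy, Real.norm_eq_abs, Real.abs_exp, Real.exp_le_exp, neg_mul,
        neg_le_neg_iff, le_div_iff₀ hε]
      linarith
    · rw [indicator_of_notMem hy, norm_zero]
      positivity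
  · refine .of_forall fun y => ?_
    have hsqrt : Tendsto (fun ε : ℝ => √ε) (𝓝[>] 0) (𝓝 0) := by
      simpa using (Real.continuous_sqrt.tendsto 0).mono_left nhdsWithin_le_nhds
    have hmove : Tendsto (fun ε : ℝ => m + √ε • y) (𝓝[>] 0) (𝓝 m) := by
      simpa using (hsqrt.smul_const y).const_add m
    have hquot : Tendsto (fun ε : ℝ => (U (m + √ε • y) - U m) / ε) (𝓝[>] 0)
        (𝓝 (⟪y, H y⟫_ℝ / 2)) := by
      have h1 := htaylor.comp_tendsto hmove
      have h2 : (fun ε : ℝ => ‖m + √ε • y - m‖ ^ 2) =O[𝓝[>] 0] fun ε : ℝ => ε := by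
        refine Asymptotics.IsBigO.of_bound (‖y‖ ^ 2) ?_
        filter_upwards [self_mem_nhdsWithin] with ε (hε : 0 < ε)
        simp [norm_smul, mul_pow, abs_of_pos hε, Real.sq_sqrt hε.le, mul_comm]
      have h3 := (h1.trans_isBigO h2).tendsto_div_nhds_zero.add_const (⟪y, H y⟫_ℝ / 2)
      rw [zero_add] at h3
      refine h3.congr' ?_
      filter_upwards [self_mem_nhdsWithin] with ε (hε : 0 < ε)
      simp only [Function.comp_apply, add_sub_cancel_left, map_smul, inner_smul_left,
        inner_smul_right, conj_trivial]
      rw [← mul_assoc, Real.mul_self_sqrt hε.le]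
      field_simp
      ring
    refine (Real.continuous_exp.tendsto _ |>.comp hquot.neg).congr' ?_
    filter_upwards [hmove (Metric.ball_mem_nhds m hr.1)] with ε hε
    simp only [F, Function.comp_apply]
    exact (indicator_of_mem (mem_preimage.1 hε) fun x => rexp (-((U x - U m) / ε))).symm

/-- Continuous functions growing superlinearly have integrable exponential `e^{-U}`. -/
lemma integrable_exp_neg_of_superlinear {d : ℕ} {U : Euc d → ℝ} (hU : Continuous U)
    (hgrowth : ∀ C : ℝ, ∃ R : ℝ, ∀ x : Euc d, R ≤ ‖x‖ → C ≤ U x / ‖x‖) :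
    Integrable fun x => rexp (-U x) := by
  obtain ⟨R, hR⟩ := hgrowth (d + 1)
  have hInt : Integrable fun x : Euc d => (1 + ‖x‖) ^ (-((d : ℝ) + 1)) :=
    integrable_one_add_norm (by simp)
  have hcont : Continuous fun x => rexp (-U x) := by fun_prop
  refine hcont.locallyIntegrable.integrable_of_isBigO_cocompact (g := fun x : Euc d =>
    (1 + ‖x‖) ^ (-((d : ℝ) + 1))) (.of_bound 1 ?_) (hInt.integrableAtFilter _)
  filter_upwards [(tendsto_norm_cocompact_atTop (E := Euc d)).eventually_ge_atTop (max R 1)]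
    with x hx
  have hx1 : 0 < ‖x‖ := by linarith [le_max_right R 1]
  have h1 := (le_div_iff₀ hx1).1 (hR x ((le_max_left R 1).trans hx))
  rw [Real.norm_eq_abs, Real.abs_exp, one_mul, Real.norm_eq_abs, abs_of_nonneg (by positivity),
    Real.rpow_def_of_pos (by positivity), Real.exp_le_exp]
  have h2 := Real.log_le_sub_one_of_pos (show 0 < 1 + ‖x‖ by positivity)
  have h3 : ((d : ℝ) + 1) * Real.log (1 + ‖x‖) ≤ ((d : ℝ) + 1) * ‖x‖ := by
    gcongr
    linarith
  linarith

/-- The part of a Laplace integral where the exponent is bounded below by a positive constant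
is negligible. -/
lemma tendsto_rpow_mul_setIntegral_exp_neg_div {d : ℕ} {V : Euc d → ℝ} {s : Set (Euc d)}
    (hs : MeasurableSet s) (hInt : Integrable fun x => rexp (-V x)) {δ : ℝ}
    (hδ : 0 < δ) (hVδ : ∀ x ∈ s, δ ≤ V x) (p : ℝ) :
    Tendsto (fun ε : ℝ => ε ^ (-p) * ∫ x in s, rexp (-(V x / ε))) (𝓝[>] 0) (𝓝 0) := by
  have hlim : Tendsto (fun ε : ℝ => rexp δ * (∫ x in s, rexp (-V x)) *
      ((ε⁻¹) ^ p * rexp (-δ * ε⁻¹))) (𝓝[>] 0) (𝓝 0) := by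
    simpa using ((tendsto_rpow_mul_exp_neg_mul_atTop_nhds_zero p δ hδ).comp
      tendsto_inv_nhdsGT_zero).const_mul (rexp δ * (∫ x in s, rexp (-V x)))
  refine squeeze_zero' ?_ ?_ hlim
  · filter_upwards [self_mem_nhdsWithin] with ε (hε : 0 < ε)
    exact mul_nonneg (by positivity) (integral_nonneg fun x => (Real.exp_pos _).le)
  · filter_upwards [Ioo_mem_nhdsGT (zero_lt_one (α := ℝ))] with ε hε
    have hle : ∫ x in s, rexp (-(V x / ε)) ≤
        ∫ x in s, rexp (δ - δ * ε⁻¹) * rexp (-V x) := by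
      refine integral_mono_of_nonneg (.of_forall fun x => (Real.exp_pos _).le)
        (hInt.integrableOn.const_mul _) ?_
      filter_upwards [ae_restrict_mem hs] with x hx
      rw [← Real.exp_add, Real.exp_le_exp, div_eq_mul_inv]
      have h1 : 1 ≤ ε⁻¹ := (one_le_inv₀ hε.1).2 hε.2.le
      nlinarith [hVδ x hx]
    rw [integral_const_mul, sub_eq_add_neg, Real.exp_add] at hle
    rw [Real.rpow_neg hε.1.le, ← Real.inv_rpow hε.1.le]
    calc _ ≤ (ε⁻¹) ^ p * (rexp δ * rexp (-(δ * ε⁻¹)) * ∫ x in s, rexp (-V x)) :=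
          mul_le_mul_of_nonneg_left hle (Real.rpow_nonneg (inv_nonneg.2 hε.1.le) _)
      _ = _ := by rw [neg_mul]; ring

/-- Outside an open set containing all minimizers, a continuous function tending to infinity
exceeds its minimum by a fixed amount. -/
lemma exists_pos_add_le_of_notMem {X : Type*} [TopologicalSpace X] {U : X → ℝ}
    (hU : Continuous U) (hcoer : Tendsto U (cocompact X) atTop) {h : ℝ} (hmin : ∀ x, h ≤ U x)
    {s : Set X} (hs : IsOpen s) (hsub : ∀ x, U x = h → x ∈ s) :
    ∃ δ > 0, ∀ x ∈ sᶜ, δ ≤ U x - h := by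
  rcases sᶜ.eq_empty_or_nonempty with he | ⟨x₀, hx₀⟩
  · exact ⟨1, one_pos, by simp [he]⟩
  · obtain ⟨y, hy, hymin⟩ := hU.continuousOn.exists_isMinOn' hs.isClosed_compl hx₀
      ((hcoer.eventually_ge_atTop (U x₀)).filter_mono inf_le_left)
    refine ⟨U y - h, sub_pos.2 ((hmin y).lt_of_ne fun he => hy (hsub y he.symm)), fun x hx => ?_⟩
    have : U y ≤ U x := hymin hx
    linarith

/-- display (3.3) of the paper: Laplace asymptotics of the partition function,
`Z_ε = (1+o(1)) (2πε)^{d/2} e^{-h/ε} ν⋆`. -/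
theorem partition_function_asymptotics {d : ℕ} (U : Euc d → ℝ)
    (hU : ContDiff ℝ 2 U) (hMorse : IsMorse U) (hGrowth : GrowthConditions U)
    (h : ℝ) (hmin : IsLeast (Set.range U) h)
    (hfin : {x : Euc d | U x = h}.Finite) (hne : {x : Euc d | U x = h}.Nonempty)
    (hcrit : ∀ m ∈ {x : Euc d | U x = h}, gradient U m = 0)
    (hpos : ∀ m ∈ {x : Euc d | U x = h},
        ∀ v : Euc d, v ≠ 0 → 0 < ⟪v, fderiv ℝ (gradient U) m v⟫_ℝ) :
    Tendsto
      (fun ε : ℝ =>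
        (∫ x : Euc d, Real.exp (-U x / ε)) * Real.exp (h / ε) * (2 * π * ε) ^ (-(d : ℝ) / 2))
      (𝓝[>] 0)
      (𝓝 (∑ᶠ m ∈ {x : Euc d | U x = h}, 1 / Real.sqrt (detHess U m))) := by
  classical
  set s := hfin.toFinset with hsdef
  have hmem : ∀ m, m ∈ s ↔ U m = h := fun m => by simp [s]
  have hUge : ∀ x, h ≤ U x := fun x => hmin.2 ⟨x, rfl⟩
  have hcont : Continuous U := hU.continuous
  obtain ⟨r, hr0, hrdisj, hrlim⟩ : ∃ r : ℝ, 0 < r ∧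
      (∀ m ∈ s, ∀ m' ∈ s, m ≠ m' → Disjoint (Metric.ball m r) (Metric.ball m' r)) ∧
      ∀ m ∈ s, Tendsto
        (fun ε : ℝ => ε ^ (-(d : ℝ) / 2) * ∫ x in Metric.ball m r, rexp (-((U x - h) / ε)))
        (𝓝[>] 0) (𝓝 ((2 * π) ^ ((d : ℝ) / 2) / √(detHess U m))) := by
    have hdisj : ∀ᶠ r in 𝓝[>] (0 : ℝ),
        ∀ m ∈ s, ∀ m' ∈ s, m ≠ m' → Disjoint (Metric.ball m r) (Metric.ball m' r) := by
      simp only [Finset.eventually_all, eventually_imp_distrib_left]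
      intro m _ m' _ hne
      filter_upwards [Ioo_mem_nhdsGT (half_pos (dist_pos.2 hne))] with r hr
      exact Metric.ball_disjoint_ball (by linarith [hr.2])
    have hlim : ∀ᶠ r in 𝓝[>] (0 : ℝ), ∀ m ∈ s, Tendsto
        (fun ε : ℝ => ε ^ (-(d : ℝ) / 2) * ∫ x in Metric.ball m r, rexp (-((U x - h) / ε)))
        (𝓝[>] 0) (𝓝 ((2 * π) ^ ((d : ℝ) / 2) / √(detHess U m))) := by
      rw [Finset.eventually_all]
      intro m hm
      have hm' := (hmem m).1 hm
      have := hU.eventually_tendsto_laplace_ball (hcrit m hm') (hpos m hm')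
      rwa [hm'] at this
    obtain ⟨r, h1, h2, h3⟩ :=
      ((eventually_mem_nhdsWithin (a := (0 : ℝ))).and (hdisj.and hlim)).exists
    exact ⟨r, h1, h2, h3⟩
  set B : Set (Euc d) := ⋃ m ∈ s, Metric.ball m r with hB
  have hBopen : IsOpen B := isOpen_biUnion fun m _ => Metric.isOpen_ball
  have hcoer : Tendsto U (cocompact (Euc d)) atTop := by
    obtain ⟨R, hR⟩ := hGrowth.1 1
    refine tendsto_atTop_mono' _ ?_ (tendsto_norm_cocompact_atTop (E := Euc d))
    filter_upwards [(tendsto_norm_cocompact_atTop (E := Euc d)).eventually_ge_atTop (max R 1)]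
      with x hx
    have hx1 : 0 < ‖x‖ := by linarith [le_max_right R 1]
    simpa using (le_div_iff₀ hx1).1 (hR x ((le_max_left R 1).trans hx))
  obtain ⟨δ, hδ, hVδ⟩ := exists_pos_add_le_of_notMem hcont hcoer hUge hBopen fun x hx =>
    mem_biUnion ((hmem x).2 hx) (Metric.mem_ball_self hr0)
  have hInt : Integrable fun x => rexp (-(U x - h)) := by
    refine ((integrable_exp_neg_of_superlinear hcont hGrowth.1).const_mul (rexp h)).congr
      (.of_forall fun x => ?_)
    simp only [← Real.exp_add]
    ring_nf
  have hfar := tendsto_rpow_mul_setIntegral_exp_neg_div hBopen.measurableSet.compl hInt hδ hVδ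
    ((d : ℝ) / 2)
  have hnear := tendsto_finsetSum s hrlim
  have hsum := (hnear.add hfar).const_mul ((2 * π) ^ (-(d : ℝ) / 2))
  rw [finsum_mem_eq_finite_toFinset_sum _ hfin, ← hsdef]
  have hval : (2 * π) ^ (-(d : ℝ) / 2) *
      (∑ m ∈ s, (2 * π) ^ ((d : ℝ) / 2) / √(detHess U m) + 0) = ∑ m ∈ s, 1 / √(detHess U m) := by
    rw [add_zero, Finset.mul_sum]
    refine Finset.sum_congr rfl fun m _ => ?_
    rw [← mul_div_assoc, ← Real.rpow_add (by positivity), neg_div, neg_add_cancel, Real.rpow_zero]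
  rw [hval] at hsum
  refine hsum.congr' ?_
  filter_upwards [Ioo_mem_nhdsGT (zero_lt_one (α := ℝ))] with ε hε
  have hε0 : 0 < ε := hε.1
  have hintε : Integrable fun x => rexp (-((U x - h) / ε)) := by
    refine hInt.mono' (by fun_prop) (.of_forall fun x => ?_)
    rw [Real.norm_eq_abs, Real.abs_exp, Real.exp_le_exp, neg_le_neg_iff]
    exact le_div_self (sub_nonneg.2 (hUge x)) hε0 hε.2.le
  have hsplit : (∫ x, rexp (-U x / ε)) * rexp (h / ε) =
      ∑ m ∈ s, (∫ x in Metric.ball m r, rexp (-((U x - h) / ε))) +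
        ∫ x in Bᶜ, rexp (-((U x - h) / ε)) := by
    rw [← integral_biUnion_finset s (fun m _ => Metric.isOpen_ball.measurableSet)
      (fun m hm m' hm' hne => hrdisj m hm m' hm' hne) (fun m _ => hintε.integrableOn),
      integral_add_compl hBopen.measurableSet hintε, ← integral_mul_const]
    refine integral_congr_ae (.of_forall fun x => ?_)
    simp only [← Real.exp_add]
    ring_nf
  rw [hsplit, Real.mul_rpow (by positivity) hε0.le, ← Finset.mul_sum, neg_div]
  ring
end
end

section
/- Let U : ℝ^d → ℝ be C² with ∇U·ℓ ≡ 0 and ∇·ℓ ≡ 0 for a C¹ vector field ℓ, satisfying the growth conditions, and let μ_ε be the Gibbs measure. Fix λ > 0, θ > 0, and a bounded measurable compactly supported function g : ℝ^d → ℝ. Suppose u : ℝ^d → ℝ is a bounded C² function such that λu − θ𝓛_ε u = g on ℝ^d, and suppose |∇u| ∈ L²(μ_ε), |ℓ| ∈ L¹(μ_ε), and |ℓ|·|∇u| ∈ L¹(μ_ε). Then the Dirichlet form satisfies θ · ε ∫_{ℝ^d} |∇u|² dμ_ε ≤ ‖u‖_∞ · ‖g‖_∞. In particular, for the resolvent equation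 with θ = θ_ε and g bounded uniformly in ε, there exists C > 0 with ε ∫ |∇u_ε|² dμ_ε ≤ C θ_ε^{−1}. -/
open Real MeasureTheory Set Filter
open scoped InnerProductSpace BigOperators Topology ENNReal

noncomputable section

/-- Cutoff functions equal to `1` eventually at every point, with gradients tending to `0`
uniformly. -/
theorem exists_cutoff_seq (d : ℕ) : ∃ (χ : ℕ → Euc d → ℝ) (M : ℝ),
    (∀ n, ContDiff ℝ 1 (χ n)) ∧ (∀ n, HasCompactSupport (χ n)) ∧ (∀ n x, |χ n x| ≤ 1) ∧
    (∀ x, Tendsto (fun n => χ n x) atTop (𝓝 1)) ∧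
    (∀ n x v, |fderiv ℝ (χ n) x v| ≤ M * ‖v‖ / (n + 1)) := by
  let φ : ContDiffBump (0 : Euc d) := ⟨1, 2, one_pos, one_lt_two⟩
  have hφ : ContDiff ℝ 1 φ := φ.contDiff
  obtain ⟨M, hM⟩ := (hφ.continuous_fderiv one_ne_zero).bounded_above_of_compact_support
    (φ.hasCompactSupport.fderiv (𝕜 := ℝ))
  have hne : ∀ n : ℕ, ((n : ℝ) + 1)⁻¹ ≠ 0 := fun n => by positivity
  refine ⟨fun n x => φ (((n : ℝ) + 1)⁻¹ • x), M, fun n => ?_, fun n => ?_, fun n x => ?_,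
    fun x => ?_, fun n x v => ?_⟩
  · exact hφ.comp (contDiff_const_smul _)
  · exact φ.hasCompactSupport.comp_smul (hne n)
  · rw [abs_of_nonneg φ.nonneg]
    exact φ.le_one
  · have h0 : Tendsto (fun n : ℕ => ((n : ℝ) + 1)⁻¹) atTop (𝓝 0) := by
      simpa [one_div] using tendsto_one_div_add_atTop_nhds_zero_nat (𝕜 := ℝ)
    have h1 : Tendsto (fun n : ℕ => φ (((n : ℝ) + 1)⁻¹ • x)) atTop (𝓝 (φ 0)) :=
      (hφ.continuous.tendsto 0).comp (by simpa using h0.smul_const x)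
    rwa [φ.one_of_mem_closedBall (by simp [φ])] at h1
  · have h : HasFDerivAt (fun x => φ (((n : ℝ) + 1)⁻¹ • x))
        ((fderiv ℝ φ (((n : ℝ) + 1)⁻¹ • x)).comp
          (((n : ℝ) + 1)⁻¹ • ContinuousLinearMap.id ℝ (Euc d))) x :=
      (hφ.differentiable one_ne_zero _).hasFDerivAt.comp x
        ((((n : ℝ) + 1)⁻¹ • ContinuousLinearMap.id ℝ (Euc d)).hasFDerivAt)
    rw [h.fderiv]
    have h2 := ((fderiv ℝ φ (((n : ℝ) + 1)⁻¹ • x)).le_opNorm v).trans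
      (mul_le_mul_of_nonneg_right (hM _) (norm_nonneg v))
    rw [Real.norm_eq_abs] at h2
    simp only [ContinuousLinearMap.comp_apply, smul_apply,
      ContinuousLinearMap.id_apply, map_smul, smul_eq_mul, abs_mul]
    rw [abs_of_nonneg (by positivity : (0 : ℝ) ≤ ((n : ℝ) + 1)⁻¹), div_eq_inv_mul]
    gcongr

/-- The divergence theorem on `ℝ^d` for an integrable `C¹` vector field with integrable
divergence. -/
theorem integral_divergence_eq_zero {d : ℕ} (V : Fin d → Euc d → ℝ)
    (hV : ∀ i, ContDiff ℝ 1 (V i)) (hVi : ∀ i, Integrable (V i))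
    (hD : Integrable fun x => ∑ i, fderiv ℝ (V i) x (EuclideanSpace.single i 1)) :
    ∫ x, ∑ i, fderiv ℝ (V i) x (EuclideanSpace.single i 1) = 0 := by
  obtain ⟨χ, M, hχ, hχc, hχ1, hχt, hχd⟩ := exists_cutoff_seq d
  set D : Euc d → ℝ := fun x => ∑ i, fderiv ℝ (V i) x (EuclideanSpace.single i 1) with hDdef
  have hlim : Tendsto (fun n => ∫ x, χ n x * D x) atTop (𝓝 (∫ x, D x)) := by
    refine tendsto_integral_of_dominated_convergence (fun x => |D x|)
      (fun n => (hχ n).continuous.aestronglyMeasurable.mul hD.aestronglyMeasurable) hD.abs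
      (fun n => Eventually.of_forall fun x => ?_) (Eventually.of_forall fun x => ?_)
    · rw [Real.norm_eq_abs, abs_mul]
      exact mul_le_of_le_one_left (abs_nonneg _) (hχ1 n x)
    · simpa using (hχt x).mul_const (D x)
  have hdc : ∀ i, Continuous fun x => fderiv ℝ (V i) x (EuclideanSpace.single i 1) := fun i =>
    ((hV i).continuous_fderiv one_ne_zero).clm_apply continuous_const
  have hχdc : ∀ n i, Continuous fun x => fderiv ℝ (χ n) x (EuclideanSpace.single i 1) :=
    fun n i => ((hχ n).continuous_fderiv one_ne_zero).clm_apply continuous_const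
  have hχds : ∀ n i,
      HasCompactSupport fun x => fderiv ℝ (χ n) x (EuclideanSpace.single i (1 : ℝ)) :=
    fun n i => (hχc n).fderiv_apply (𝕜 := ℝ) _
  have hparts : ∀ n, ∫ x, χ n x * D x
      = ∑ i, -∫ x, fderiv ℝ (χ n) x (EuclideanSpace.single i 1) * V i x := by
    intro n
    have h1 : ∀ i, Integrable fun x =>
        χ n x * fderiv ℝ (V i) x (EuclideanSpace.single i 1) := fun i =>
      ((hχ n).continuous.mul (hdc i)).integrable_of_hasCompactSupport (hχc n).mul_right
    simp only [hDdef, Finset.mul_sum]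
    rw [integral_finsetSum _ fun i _ => h1 i]
    refine Finset.sum_congr rfl fun i _ => ?_
    exact integral_mul_fderiv_eq_neg_fderiv_mul_of_integrable
      (((hχdc n i).mul (hV i).continuous).integrable_of_hasCompactSupport
        (hχds n i).mul_right) (h1 i)
      (((hχ n).continuous.mul (hV i).continuous).integrable_of_hasCompactSupport
        (hχc n).mul_right)
      (fun x _ => (hχ n).differentiable one_ne_zero x)
      (fun x _ => (hV i).differentiable one_ne_zero x)
  have hzero : Tendsto (fun n => ∫ x, χ n x * D x) atTop (𝓝 0) := by
    simp only [hparts]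
    rw [show (0 : ℝ) = ∑ _i : Fin d, -0 by simp]
    refine tendsto_finsetSum _ fun i _ => Tendsto.neg ?_
    refine squeeze_zero_norm (a := fun n : ℕ => (1 / ((n : ℝ) + 1)) * (M * ∫ x, |V i x|))
      (fun n => ?_) ?_
    · refine (norm_integral_le_integral_norm _).trans ?_
      rw [← mul_assoc, ← integral_const_mul]
      refine integral_mono_of_nonneg (Eventually.of_forall fun x => norm_nonneg _)
        ((hVi i).abs.const_mul _) (Eventually.of_forall fun x => ?_)
      have := hχd n x (EuclideanSpace.single i 1)
      simp only [norm_mul, Real.norm_eq_abs]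
      refine mul_le_mul_of_nonneg_right (this.trans_eq ?_) (abs_nonneg _)
      simp
      ring
    · simpa using (tendsto_one_div_add_atTop_nhds_zero_nat (𝕜 := ℝ)).mul_const
        (M * ∫ x, |V i x|)
  exact tendsto_nhds_unique hlim hzero

theorem integrable_exp_neg_norm (d : ℕ) : Integrable fun x : Euc d => Real.exp (-‖x‖) := by
  have h := integrable_one_add_norm (μ := (volume : Measure (Euc d)))
    (r := ((d + 1 : ℕ) : ℝ)) (by simp)
  refine (h.const_mul (((d + 1).factorial : ℝ) * Real.exp 1)).mono'
    (by fun_prop) (Eventually.of_forall fun x => ?_)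
  have hp : 0 < 1 + ‖x‖ := by positivity
  have h1 := Real.pow_div_factorial_le_exp (1 + ‖x‖) hp.le (d + 1)
  rw [Real.norm_eq_abs, Real.abs_exp, Real.rpow_neg hp.le, Real.rpow_natCast, Real.exp_neg,
    ← div_eq_mul_inv, le_div_iff₀ (by positivity), inv_mul_le_iff₀ (Real.exp_pos _),
    mul_comm (Real.exp ‖x‖), mul_assoc, ← Real.exp_add]
  rwa [div_le_iff₀ (by positivity), mul_comm] at h1

/-- Superlinear growth of the potential makes the Gibbs weight integrable. -/
theorem integrable_gibbs_weight {d : ℕ} {U : Euc d → ℝ} (hU : Continuous U)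
    (hgrow : ∀ C : ℝ, ∃ R : ℝ, ∀ x : Euc d, R ≤ ‖x‖ → C ≤ U x / ‖x‖) {ε : ℝ} (hε : 0 < ε) :
    Integrable fun x => Real.exp (-U x / ε) := by
  obtain ⟨R, hR⟩ := hgrow ε
  obtain ⟨K, hK⟩ := (isCompact_closedBall (0 : Euc d) (max R 1)).exists_bound_of_continuousOn
    (f := fun x => ‖x‖ - U x / ε) (by fun_prop)
  refine ((integrable_exp_neg_norm d).const_mul (Real.exp |K|)).mono' (by fun_prop)
    (Eventually.of_forall fun x => ?_)
  rw [Real.norm_eq_abs, Real.abs_exp, ← Real.exp_add]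
  refine Real.exp_le_exp.2 ?_
  rw [neg_div]
  rcases le_total ‖x‖ (max R 1) with h | h
  · have := (le_abs_self _).trans ((hK x (by simpa using h)).trans (le_abs_self K))
    linarith
  · have hx : 0 < ‖x‖ := one_pos.trans_le ((le_max_right _ _).trans h)
    have h1 := hR x ((le_max_left _ _).trans h)
    rw [le_div_iff₀ hx] at h1
    have h2 : ‖x‖ ≤ U x / ε := by
      rw [le_div_iff₀ hε]
      linarith
    linarith [abs_nonneg K]

theorem integrable_gibbs_iff {d : ℕ} {U : Euc d → ℝ} (hU : Continuous U) {ε : ℝ}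
    (hZ : 0 < ∫ x : Euc d, Real.exp (-U x / ε)) {f : Euc d → ℝ} :
    Integrable f (gibbs U ε) ↔ Integrable fun x => Real.exp (-U x / ε) * f x := by
  rw [gibbs, integrable_smul_measure (by simp) (by simpa using hZ),
    integrable_withDensity_iff_integrable_smul' (by fun_prop) (by simp)]
  simp [ENNReal.toReal_ofReal (Real.exp_pos _).le]

theorem integral_gibbs {d : ℕ} {U : Euc d → ℝ} (hU : Continuous U) {ε : ℝ}
    (f : Euc d → ℝ) : ∫ x, f x ∂(gibbs U ε)
      = (∫ x : Euc d, Real.exp (-U x / ε))⁻¹ * ∫ x, Real.exp (-U x / ε) * f x := by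
  have hZ : 0 ≤ ∫ x : Euc d, Real.exp (-U x / ε) :=
    integral_nonneg fun x => (Real.exp_pos _).le
  rw [gibbs, integral_smul_measure,
    integral_withDensity_eq_integral_toReal_smul (by fun_prop) (by simp)]
  simp [ENNReal.toReal_ofReal (Real.exp_pos _).le, ENNReal.toReal_ofReal hZ]

theorem gradient_apply_eq_fderiv {d : ℕ} (f : Euc d → ℝ) (x : Euc d) (i : Fin d) :
    gradient f x i = fderiv ℝ f x (EuclideanSpace.single i 1) := by
  rw [← inner_gradient_left, EuclideanSpace.inner_single_right]
  simp

/-- The components of the flux `e^{-U/ε} (u² ℓ / 2 - ε u ∇u)`. -/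
def flux {d : ℕ} (U : Euc d → ℝ) (ℓ : Euc d → Euc d) (ε : ℝ) (u : Euc d → ℝ)
    (i : Fin d) (x : Euc d) : ℝ :=
  Real.exp (-U x / ε) *
    (u x * (u x * ℓ x i / 2 - ε * fderiv ℝ u x (EuclideanSpace.single i 1)))

section flux

variable {d : ℕ} {U : Euc d → ℝ} {ℓ : Euc d → Euc d} {u : Euc d → ℝ}

theorem contDiff_fderiv_apply (hu : ContDiff ℝ 2 u) (v : Euc d) :
    ContDiff ℝ 1 fun x => fderiv ℝ u x v :=
  (hu.fderiv_right (m := 1) (by norm_num)).clm_apply contDiff_const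

theorem contDiff_component (hℓ : ContDiff ℝ 1 ℓ) (i : Fin d) : ContDiff ℝ 1 fun x => ℓ x i :=
  (EuclideanSpace.proj (𝕜 := ℝ) i).contDiff.comp hℓ

theorem contDiff_flux (hU : ContDiff ℝ 2 U) (hℓ : ContDiff ℝ 1 ℓ) (hu : ContDiff ℝ 2 u)
    (ε : ℝ) (i : Fin d) : ContDiff ℝ 1 (flux U ℓ ε u i) := by
  have hU1 : ContDiff ℝ 1 U := hU.of_le (by norm_num)
  have hu1 : ContDiff ℝ 1 u := hu.of_le (by norm_num)
  have hp := contDiff_fderiv_apply hu (EuclideanSpace.single i 1)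
  have hl := contDiff_component hℓ i
  unfold flux
  exact ((hU1.neg.div_const ε).exp).mul
    (hu1.mul (((hu1.mul hl).div_const 2).sub (contDiff_const.mul hp)))

theorem divergence_flux (hU : ContDiff ℝ 2 U) (hℓ : ContDiff ℝ 1 ℓ) (hu : ContDiff ℝ 2 u)
    (horth : ∀ x : Euc d, ⟪gradient U x, ℓ x⟫_ℝ = 0) (hdivℓ : ∀ x : Euc d, vdiv ℓ x = 0)
    {ε : ℝ} (hε : ε ≠ 0) (x : Euc d) :
    ∑ i, fderiv ℝ (flux U ℓ ε u i) x (EuclideanSpace.single i 1)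
      = Real.exp (-U x / ε) * (-(u x * gen U ℓ ε u x) - ε * ‖gradient u x‖ ^ 2) := by
  have hd : ∀ i : Fin d, fderiv ℝ (flux U ℓ ε u i) x (EuclideanSpace.single i 1)
      = Real.exp (-U x / ε) *
        (u x * (gradient U x i * gradient u x i) - u x ^ 2 / (2 * ε) * (gradient U x i * ℓ x i)
        + u x * (ℓ x i * gradient u x i) + u x ^ 2 / 2
            * fderiv ℝ (fun y => ℓ y i) x (EuclideanSpace.single i 1)
        - ε * u x * fderiv ℝ (fun y => fderiv ℝ u y (EuclideanSpace.single i 1)) x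
            (EuclideanSpace.single i 1)
        - ε * gradient u x i ^ 2) := by
    intro i
    have hU' := (hU.differentiable two_ne_zero x).hasFDerivAt
    have hu' := (hu.differentiable two_ne_zero x).hasFDerivAt
    have hp' := ((contDiff_fderiv_apply hu
      (EuclideanSpace.single i 1)).differentiable one_ne_zero x).hasFDerivAt
    have hl' := ((contDiff_component hℓ i).differentiable one_ne_zero x).hasFDerivAt
    have h := ((hU'.neg.mul_const ε⁻¹).exp).mul
      (hu'.mul (((hu'.mul hl').mul_const (2⁻¹)).sub (hp'.const_mul ε)))
    rw [show flux U ℓ ε u i = (fun x => Real.exp (-U x * ε⁻¹)) * (u * ((fun x => u x * ℓ x i * 2⁻¹)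
      - fun x => ε * fderiv ℝ u x (EuclideanSpace.single i 1))) from rfl]
    have h2 := congrArg (fun L => L (EuclideanSpace.single i (1 : ℝ))) h.fderiv
    refine h2.trans ?_
    simp only [gradient_apply_eq_fderiv, add_apply,
      smul_apply, sub_apply,
      neg_apply, smul_eq_mul, Pi.mul_apply, Pi.sub_apply, Pi.neg_apply,
      div_eq_mul_inv]
    field_simp
    ring
  have hinner : ∀ a b : Euc d, ⟪a, b⟫_ℝ = ∑ i, a i * b i := fun a b => by
    simp [PiLp.inner_apply, mul_comm]
  have ho := horth x
  have hdiv := hdivℓ x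
  rw [hinner] at ho
  rw [vdiv] at hdiv
  have hn : ‖gradient u x‖ ^ 2 = ∑ i, gradient u x i ^ 2 := by
    simp [EuclideanSpace.norm_sq_eq]
  simp only [hd]
  rw [← Finset.mul_sum]
  simp only [Finset.sum_add_distrib, Finset.sum_sub_distrib, ← Finset.mul_sum]
  rw [ho, hdiv, gen, inner_add_left, hinner, hinner, lap, hn]
  ring

theorem integrable_flux (hU : ContDiff ℝ 2 U) (hℓ : ContDiff ℝ 1 ℓ) (hu : ContDiff ℝ 2 u)
    {ε C : ℝ} (hC : ∀ x, |u x| ≤ C) (hw : Integrable fun x => Real.exp (-U x / ε))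
    (hL2 : Integrable fun x => Real.exp (-U x / ε) * ‖gradient u x‖ ^ 2)
    (hL1 : Integrable fun x => Real.exp (-U x / ε) * ‖ℓ x‖) (i : Fin d) :
    Integrable (flux U ℓ ε u i) := by
  refine ((hL1.const_mul (C * C)).add ((hw.add hL2).const_mul (C * |ε|))).mono'
    (contDiff_flux hU hℓ hu ε i).continuous.aestronglyMeasurable
    (Eventually.of_forall fun x => ?_)
  have hC0 : 0 ≤ C := (abs_nonneg _).trans (hC x)
  have hl : |ℓ x i| ≤ ‖ℓ x‖ := by simpa using PiLp.norm_apply_le (ℓ x) i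
  have hp : |fderiv ℝ u x (EuclideanSpace.single i 1)| ≤ 1 + ‖gradient u x‖ ^ 2 := by
    have : |gradient u x i| ≤ ‖gradient u x‖ := by
      simpa using PiLp.norm_apply_le (gradient u x) i
    rw [← gradient_apply_eq_fderiv]
    nlinarith [sq_nonneg (‖gradient u x‖ - 1)]
  have h1 : |u x * (u x * ℓ x i / 2 - ε * fderiv ℝ u x (EuclideanSpace.single i 1))|
      ≤ C * (C * ‖ℓ x‖ + |ε| * (1 + ‖gradient u x‖ ^ 2)) := by
    rw [abs_mul]
    refine mul_le_mul (hC x) ((abs_sub _ _).trans (add_le_add ?_ ?_)) (abs_nonneg _) hC0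
    · rw [abs_div, abs_mul, abs_two]
      have : |u x| * |ℓ x i| ≤ C * ‖ℓ x‖ := mul_le_mul (hC x) hl (abs_nonneg _) hC0
      have : 0 ≤ |u x| * |ℓ x i| := by positivity
      linarith
    · rw [abs_mul]
      gcongr
  rw [flux, Real.norm_eq_abs, abs_mul, Real.abs_exp]
  refine (mul_le_mul_of_nonneg_left h1 (Real.exp_pos _).le).trans_eq ?_
  simp only [Pi.add_apply]
  ring

end flux

/-- Proposition 5.2 of the paper, energy estimate: a bounded `C²` solution of
the resolvent equation `λu - θ𝓛_ε u = g` satisfies `θ · ε ∫ |∇u|² dμ_ε ≤ ‖u‖_∞ ‖g‖_∞`. -/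
theorem energy_estimate {d : ℕ} (U : Euc d → ℝ) (ℓ : Euc d → Euc d)
    (hU : ContDiff ℝ 2 U) (hℓ : ContDiff ℝ 1 ℓ)
    (horth : ∀ x : Euc d, ⟪gradient U x, ℓ x⟫_ℝ = 0)
    (hdivℓ : ∀ x : Euc d, vdiv ℓ x = 0)
    (hGrowth : GrowthConditions U)
    (ε θ lam : ℝ) (hε : 0 < ε) (hθ : 0 < θ) (hlam : 0 < lam)
    (g : Euc d → ℝ) (hgm : Measurable g) (hgb : ∃ C, ∀ x, |g x| ≤ C)
    (hgsupp : HasCompactSupport g)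
    (u : Euc d → ℝ) (hu : ContDiff ℝ 2 u) (hub : ∃ C, ∀ x, |u x| ≤ C)
    (heq : ∀ x : Euc d, lam * u x - θ * gen U ℓ ε u x = g x)
    (hL2 : Integrable (fun x => ‖gradient u x‖ ^ 2) (gibbs U ε))
    (hL1ℓ : Integrable (fun x => ‖ℓ x‖) (gibbs U ε))
    (hL1ℓu : Integrable (fun x => ‖ℓ x‖ * ‖gradient u x‖) (gibbs U ε)) :
    θ * (ε * ∫ x, ‖gradient u x‖ ^ 2 ∂(gibbs U ε))
      ≤ (⨆ x : Euc d, |u x|) * (⨆ x : Euc d, |g x|) := by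
  have hUc := hU.continuous
  have huc := hu.continuous
  have hw := integrable_gibbs_weight hUc hGrowth.1 hε
  have hZ : 0 < ∫ x : Euc d, Real.exp (-U x / ε) := integral_exp_pos hw
  rw [integrable_gibbs_iff hUc hZ] at hL2 hL1ℓ
  obtain ⟨Cu, hCu⟩ := hub
  obtain ⟨Cg, hCg⟩ := hgb
  set A := ⨆ x : Euc d, |u x|
  set B := ⨆ x : Euc d, |g x|
  have hA : ∀ x, |u x| ≤ A := le_ciSup ⟨Cu, by rintro _ ⟨x, rfl⟩; exact hCu x⟩
  have hB : ∀ x, |g x| ≤ B := le_ciSup ⟨Cg, by rintro _ ⟨x, rfl⟩; exact hCg x⟩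
  have hA0 : 0 ≤ A := (abs_nonneg _).trans (hA 0)
  have hgu : Integrable fun x => Real.exp (-U x / ε) * (u x * g x) := by
    refine hw.mul_bdd (c := A * B) (huc.measurable.mul hgm).aestronglyMeasurable
      (Eventually.of_forall fun x => ?_)
    rw [Real.norm_eq_abs, abs_mul]
    exact mul_le_mul (hA x) (hB x) (abs_nonneg _) hA0
  have huu : Integrable fun x => Real.exp (-U x / ε) * (u x * u x) := by
    refine hw.mul_bdd (c := A * A) (huc.mul huc).aestronglyMeasurable
      (Eventually.of_forall fun x => ?_)
    rw [Real.norm_eq_abs, abs_mul]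
    exact mul_le_mul (hA x) (hA x) (abs_nonneg _) hA0
  have hdiv : ∀ x, ∑ i, fderiv ℝ (flux U ℓ ε u i) x (EuclideanSpace.single i 1)
      = θ⁻¹ * (Real.exp (-U x / ε) * (u x * g x)
          - lam * (Real.exp (-U x / ε) * (u x * u x))
          - θ * ε * (Real.exp (-U x / ε) * ‖gradient u x‖ ^ 2)) := by
    intro x
    rw [divergence_flux hU hℓ hu horth hdivℓ hε.ne', ← heq x]
    field_simp
    ring
  have hzero := integral_divergence_eq_zero (flux U ℓ ε u) (contDiff_flux hU hℓ hu ε)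
    (integrable_flux hU hℓ hu hA hw hL2 hL1ℓ)
    (by
      simp only [hdiv]
      exact ((hgu.sub (huu.const_mul lam)).sub (hL2.const_mul (θ * ε))).const_mul θ⁻¹)
  simp only [hdiv] at hzero
  rw [integral_const_mul, integral_sub (by exact hgu.sub (huu.const_mul lam)) (hL2.const_mul (θ * ε)),
    integral_sub hgu (huu.const_mul lam), integral_const_mul, integral_const_mul] at hzero
  have hzero' := (mul_eq_zero.1 hzero).resolve_left (inv_ne_zero hθ.ne')
  have huu0 : 0 ≤ ∫ x, Real.exp (-U x / ε) * (u x * u x) :=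
    integral_nonneg fun x => mul_nonneg (Real.exp_pos _).le (mul_self_nonneg _)
  have hgu_le : ∫ x, Real.exp (-U x / ε) * (u x * g x)
      ≤ (∫ x, Real.exp (-U x / ε)) * (A * B) := by
    rw [← integral_mul_const]
    refine integral_mono hgu (hw.mul_const _) fun x => ?_
    refine mul_le_mul_of_nonneg_left ((le_abs_self _).trans ?_) (Real.exp_pos _).le
    rw [abs_mul]
    exact mul_le_mul (hA x) (hB x) (abs_nonneg _) hA0
  rw [integral_gibbs hUc]
  have hlu := mul_nonneg hlam.le huu0
  calc θ * (ε * ((∫ x, Real.exp (-U x / ε))⁻¹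
        * ∫ x, Real.exp (-U x / ε) * ‖gradient u x‖ ^ 2))
      = (∫ x, Real.exp (-U x / ε))⁻¹
        * (θ * ε * ∫ x, Real.exp (-U x / ε) * ‖gradient u x‖ ^ 2) := by ring
    _ ≤ A * B := by
      rw [inv_mul_le_iff₀ hZ]
      linarith
end
end

section
/- Let U : ℝ^d → ℝ be C² and let J : ℝ → M_{d×d}(ℝ) be a C¹ map such that J(a) is skew-symmetric (J(a)ᵀ = −J(a)) for every a ∈ ℝ. Then the C¹ vector field ℓ(x) := J(U(x)) ∇U(x) satisfies ∇U(x)·ℓ(x) = 0 and (∇·ℓ)(x) = 0 for all x ∈ ℝ^d. -/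
open Real MeasureTheory Set Filter
open scoped InnerProductSpace BigOperators Topology ENNReal

noncomputable section

/-- The full contraction of a skew-symmetric array with a symmetric one vanishes. -/
lemma sum_sum_skew_mul_symm_eq_zero {ι : Type*} [Fintype ι] (A S : ι → ι → ℝ)
    (hA : ∀ i j, A j i = -A i j) (hS : ∀ i j, S j i = S i j) :
    ∑ i, ∑ j, A i j * S i j = 0 := by
  have h : ∑ i, ∑ j, A i j * S i j = -∑ i, ∑ j, A i j * S i j := by
    conv_lhs => rw [Finset.sum_comm]
    simp only [← Finset.sum_neg_distrib]
    refine Finset.sum_congr rfl fun i _ => Finset.sum_congr rfl fun j _ => ?_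
    rw [hA i j, hS i j, neg_mul]
  linarith

lemma gradient_apply_eq_fderiv_single {d : ℕ} (U : Euc d → ℝ) (x : Euc d) (j : Fin d) :
    gradient U x j = fderiv ℝ U x (EuclideanSpace.single j 1) := by
  have h := InnerProductSpace.toDual_symm_apply (𝕜 := ℝ)
    (x := EuclideanSpace.single j (1 : ℝ)) (y := fderiv ℝ U x)
  rw [← h, EuclideanSpace.inner_single_right]
  simp [gradient]

/-- The product rule for the matrix-vector product `A(U(x)) ∇U(x)`, one entry at a time. -/
lemma hasFDerivAt_comp_mul_gradient_apply {d : ℕ} {U : Euc d → ℝ} (hU : ContDiff ℝ 2 U)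
    {a : ℝ → ℝ} (x : Euc d) (ha : DifferentiableAt ℝ a (U x)) (j : Fin d) :
    HasFDerivAt (fun y => a (U y) * gradient U y j)
      (a (U x) • (fderiv ℝ (fderiv ℝ U) x).flip (EuclideanSpace.single j 1) +
        gradient U x j • deriv a (U x) • fderiv ℝ U x) x := by
  have hU₁ : HasFDerivAt U (fderiv ℝ U x) x :=
    (hU.differentiable (by norm_num) x).hasFDerivAt
  have hU₂ : HasFDerivAt (fderiv ℝ U) (fderiv ℝ (fderiv ℝ U) x) x :=
    ((hU.fderiv_right (m := 1) (by norm_num)).differentiable (by norm_num) x).hasFDerivAt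
  have hg : HasFDerivAt (fun y => gradient U y j)
      ((fderiv ℝ (fderiv ℝ U) x).flip (EuclideanSpace.single j 1)) x := by
    simp only [gradient_apply_eq_fderiv_single]
    exact (hU₂.clm_apply (hasFDerivAt_const (EuclideanSpace.single j (1 : ℝ)) x)).congr_fderiv
      (by ext v; simp)
  exact (ha.hasDerivAt.comp_hasFDerivAt x hU₁).mul hg

/-- if `J(a)` is a skew-symmetric matrix depending in a `C¹` way on `a`, then
the vector field `ℓ(x) = J(U(x)) ∇U(x)` is orthogonal to `∇U` and divergence free. -/
theorem skew_construction_orth_divFree {d : ℕ} (U : Euc d → ℝ) (hU : ContDiff ℝ 2 U)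
    (J : ℝ → Fin d → Fin d → ℝ) (hJ : ContDiff ℝ 1 J)
    (hskew : ∀ (a : ℝ) (i j : Fin d), J a j i = - J a i j) :
    ∀ x : Euc d,
      ⟪gradient U x,
        ((WithLp.equiv 2 (Fin d → ℝ)).symm fun i => ∑ j, J (U x) i j * gradient U x j)⟫_ℝ = 0
      ∧ vdiv
          (fun y => (WithLp.equiv 2 (Fin d → ℝ)).symm fun i => ∑ j, J (U y) i j * gradient U y j)
          x = 0 := by
  intro x
  constructor
  · rw [PiLp.inner_apply, ← sum_sum_skew_mul_symm_eq_zero (J (U x))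
      (fun i j => gradient U x i * gradient U x j) (hskew _) (fun i j => mul_comm _ _)]
    refine Finset.sum_congr rfl fun i _ => ?_
    simp only [WithLp.equiv_symm_apply, RCLike.inner_apply, conj_trivial, Finset.sum_mul]
    exact Finset.sum_congr rfl fun j _ => by ring
  · have hJd : ∀ i j, DifferentiableAt ℝ (fun a => J a i j) (U x) := fun i j =>
      differentiableAt_pi.1 (differentiableAt_pi.1 (hJ.differentiable (by norm_num) (U x)) i) j
    have hJskew : ∀ i j, deriv (fun a => J a j i) (U x) = -deriv (fun a => J a i j) (U x) := by
      intro i j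
      simp only [hskew _ i j]
      exact deriv.fun_neg
    have hsymm : IsSymmSndFDerivAt ℝ U x := hU.contDiffAt.isSymmSndFDerivAt (by simp)
    have h₁ := sum_sum_skew_mul_symm_eq_zero (fun i j => deriv (fun a => J a i j) (U x))
      (fun i j => gradient U x i * gradient U x j) hJskew (fun i j => mul_comm _ _)
    have h₂ := sum_sum_skew_mul_symm_eq_zero (J (U x))
      (fun i j => fderiv ℝ (fderiv ℝ U) x (EuclideanSpace.single i 1) (EuclideanSpace.single j 1))
      (hskew _) (fun i j => hsymm.eq _ _)
    rw [vdiv, ← add_zero (0 : ℝ)]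
    nth_rewrite 1 [← h₂]
    rw [← h₁, ← Finset.sum_add_distrib]
    refine Finset.sum_congr rfl fun i _ => ?_
    have h := HasFDerivAt.fun_sum (u := Finset.univ) fun j _ =>
      hasFDerivAt_comp_mul_gradient_apply hU x (hJd i j) j
    simp only [WithLp.equiv_symm_apply]
    rw [h.fderiv, sum_apply, ← Finset.sum_add_distrib]
    refine Finset.sum_congr rfl fun j _ => ?_
    simp only [add_apply, smul_apply,
      ContinuousLinearMap.flip_apply, smul_eq_mul, gradient_apply_eq_fderiv_single]
    ring
end
end

section
/- Let U : ℝ^d → ℝ be C², a Morse function, satisfying the growth conditions, with h = min U attained at at least one nondegenerate global minimum. Let H > h and let μ_ε be the Gibbs measure. Then for every J > 0 there exists a constant C > 0 such that for all sufficiently small ε > 0, μ_ε( { x : U(x) ≥ H + J² ε log(1/ε) } ) ≤ C e^{−(H−h)/ε} ε^{J² − d/2}. -/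
open Real MeasureTheory Set Filter
open scoped InnerProductSpace BigOperators Topology ENNReal

noncomputable section

/-- A continuous function growing at least linearly at infinity has an integrable `exp (-U)`. -/
lemma integrable_exp_neg_of_norm_le {d : ℕ} {U : Euc d → ℝ} (hU : Continuous U) {M : ℝ}
    (hM : ∀ x, ‖x‖ - M ≤ U x) : Integrable fun x => Real.exp (-U x) := by
  have hint := (integrable_one_add_norm (E := Euc d) (μ := volume) (r := ((d + 1 : ℕ) : ℝ))
    (by rw [finrank_euclideanSpace_fin]; push_cast; linarith)).const_mul
      (Real.exp (M + 1) * (d + 1).factorial)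
  refine hint.mono' (by fun_prop) (Eventually.of_forall fun x => ?_)
  have hpos : (0 : ℝ) < (1 + ‖x‖) ^ (d + 1) := by positivity
  have hfac : (0 : ℝ) < (d + 1).factorial := by positivity
  have hpow := Real.pow_div_factorial_le_exp (1 + ‖x‖) (by positivity) (d + 1)
  rw [div_le_iff₀ hfac] at hpow
  rw [Real.norm_eq_abs, abs_of_pos (Real.exp_pos _), Real.rpow_neg (by positivity),
    Real.rpow_natCast, ← div_eq_mul_inv, le_div_iff₀ hpos]
  calc Real.exp (-U x) * (1 + ‖x‖) ^ (d + 1)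
      ≤ Real.exp (M - ‖x‖) * (Real.exp (1 + ‖x‖) * (d + 1).factorial) := by
        gcongr
        linarith [hM x]
    _ = Real.exp (M + 1) * (d + 1).factorial := by
        rw [← mul_assoc, ← Real.exp_add]
        ring_nf

/-- Superlinear growth of a continuous function yields a global linear lower bound. -/
lemma exists_norm_sub_le_of_growth {d : ℕ} {U : Euc d → ℝ} {h : ℝ} (hmin : ∀ x, h ≤ U x)
    (hgrowth : ∀ C : ℝ, ∃ R : ℝ, ∀ x : Euc d, R ≤ ‖x‖ → C ≤ U x / ‖x‖) :
    ∃ M : ℝ, ∀ x, ‖x‖ - M ≤ U x := by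
  obtain ⟨R, hR⟩ := hgrowth 1
  refine ⟨|R| + |h| + 1, fun x => ?_⟩
  by_cases hx : |R| + 1 ≤ ‖x‖
  · have hx0 : 0 < ‖x‖ := by linarith [abs_nonneg R]
    have := hR x (by linarith [le_abs_self R])
    rw [le_div_iff₀ hx0] at this
    linarith [abs_nonneg R, abs_nonneg h]
  · linarith [hmin x, neg_abs_le h]

/-- A `C²` function is bounded above quadratically near a minimum. -/
lemma exists_quadratic_upper_bound {E : Type*} [NormedAddCommGroup E] [NormedSpace ℝ E]
    {U : E → ℝ} (hU : ContDiff ℝ 2 U) {m : E} (hmin : IsLocalMin U m) :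
    ∃ K : ℝ, ∃ r > 0, ∀ x, ‖x - m‖ < r → U x ≤ U m + K * ‖x - m‖ ^ 2 := by
  have hderiv : ContDiff ℝ 1 (fderiv ℝ U) := hU.fderiv_right (by norm_num)
  obtain ⟨K, s, hs, hK⟩ := hderiv.contDiffAt.exists_lipschitzOnWith (x := m)
  obtain ⟨r, hr, hrs⟩ := Metric.mem_nhds_iff.1 hs
  refine ⟨K, r, hr, fun x hx => ?_⟩
  have hbound : ∀ y ∈ Metric.closedBall m ‖x - m‖, ‖fderiv ℝ U y‖ ≤ K * ‖x - m‖ := by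
    intro y hy
    have hyr : y ∈ Metric.ball m r := Metric.closedBall_subset_ball hx hy
    have := hK.dist_le_mul y (hrs hyr) m (hrs (Metric.mem_ball_self hr))
    rw [hmin.fderiv_eq_zero, dist_zero_right] at this
    exact this.trans (mul_le_mul_of_nonneg_left (Metric.mem_closedBall.1 hy) K.2)
  have := (convex_closedBall m ‖x - m‖).norm_image_sub_le_of_norm_fderiv_le
    (fun y _ => (hU.differentiable (by norm_num)) y) hbound
    (Metric.mem_closedBall_self (norm_nonneg _))
    (show x ∈ Metric.closedBall m ‖x - m‖ by simp [dist_eq_norm])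
  have := (Real.le_norm_self _).trans this
  nlinarith

/-- Dividing the energy by a temperature `ε ≤ 1` decreases the Gibbs weight above level `a`. -/
lemma exp_neg_div_le {a u ε : ℝ} (hu : a ≤ u) (hε : 0 < ε) (hε1 : ε ≤ 1) :
    Real.exp (-u / ε) ≤ Real.exp (-a / ε) * (Real.exp a * Real.exp (-u)) := by
  rw [← Real.exp_add, ← Real.exp_add, Real.exp_le_exp]
  have : u - a ≤ (u - a) / ε := by
    rw [le_div_iff₀ hε]
    nlinarith
  have e : -u / ε = -a / ε - (u - a) / ε := by ring
  linarith

/-- At temperature `ε ≤ 1` the Gibbs weight is integrable as soon as it is at temperature `1`. -/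
lemma integrable_exp_neg_div {d : ℕ} {U : Euc d → ℝ} (hU : Continuous U) {h : ℝ}
    (hmin : ∀ x, h ≤ U x) (hint : Integrable fun x => Real.exp (-U x)) {ε : ℝ} (hε : 0 < ε)
    (hε1 : ε ≤ 1) : Integrable fun x => Real.exp (-U x / ε) := by
  refine ((hint.const_mul (Real.exp h)).const_mul (Real.exp (-h / ε))).mono' (by fun_prop)
    (Eventually.of_forall fun x => ?_)
  rw [Real.norm_eq_abs, abs_of_pos (Real.exp_pos _)]
  exact exp_neg_div_le (hmin x) hε hε1

/-- Upper bound on the unnormalized Gibbs mass of a superlevel set. -/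
lemma setIntegral_superlevel_le {d : ℕ} {U : Euc d → ℝ} (hU : Continuous U) {h : ℝ}
    (hmin : ∀ x, h ≤ U x) (hint : Integrable fun x => Real.exp (-U x)) (a : ℝ) {ε : ℝ}
    (hε : 0 < ε) (hε1 : ε ≤ 1) :
    ∫ x in {x | a ≤ U x}, Real.exp (-U x / ε) ≤
      Real.exp (-a / ε) * (Real.exp a * ∫ x, Real.exp (-U x)) := by
  have hS : MeasurableSet {x | a ≤ U x} := measurableSet_le measurable_const hU.measurable
  have hbound := (hint.const_mul (Real.exp a)).const_mul (Real.exp (-a / ε))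
  calc ∫ x in {x | a ≤ U x}, Real.exp (-U x / ε)
      ≤ ∫ x in {x | a ≤ U x}, Real.exp (-a / ε) * (Real.exp a * Real.exp (-U x)) :=
        setIntegral_mono_on (integrable_exp_neg_div hU hmin hint hε hε1).integrableOn
          hbound.integrableOn hS fun x hx => exp_neg_div_le hx hε hε1
    _ ≤ ∫ x, Real.exp (-a / ε) * (Real.exp a * Real.exp (-U x)) :=
        setIntegral_le_integral hbound (Eventually.of_forall fun x => by positivity)
    _ = _ := by rw [integral_const_mul, integral_const_mul]

/-- Lower bound on the partition function, from a quadratic upper bound on the potential. -/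
lemma exists_partition_lower_bound {d : ℕ} {U : Euc d → ℝ} (hU : ContDiff ℝ 2 U) {m : Euc d}
    (hmin : ∀ x, U m ≤ U x) (hint : Integrable fun x => Real.exp (-U x)) :
    ∃ c > (0 : ℝ), ∃ ε₀ > (0 : ℝ), ∀ ε ∈ Set.Ioo (0 : ℝ) ε₀,
      c * Real.exp (-U m / ε) * ε ^ ((d : ℝ) / 2) ≤ ∫ x, Real.exp (-U x / ε) := by
  obtain ⟨K, r, hr, hK⟩ := exists_quadratic_upper_bound hU (Eventually.of_forall hmin)
  refine ⟨Real.exp (-|K|) * volume.real (Metric.ball (0 : Euc d) 1),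
    mul_pos (Real.exp_pos _) (ENNReal.toReal_pos (Metric.measure_ball_pos _ _ one_pos).ne'
      measure_ball_lt_top.ne), min 1 (r ^ 2), by positivity,
    fun ε hε => ?_⟩
  have hε0 := hε.1
  have hε1 : ε ≤ 1 := (hε.2.trans_le (min_le_left _ _)).le
  have hεr : √ε < r := (Real.sqrt_lt' hr).2 (hε.2.trans_le (min_le_right _ _))
  have hZ := integrable_exp_neg_div hU.continuous hmin hint hε0 hε1
  have hsqrt : √ε ^ d = ε ^ ((d : ℝ) / 2) := by
    rw [Real.sqrt_eq_rpow, ← Real.rpow_natCast, ← Real.rpow_mul hε0.le]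
    ring_nf
  calc Real.exp (-|K|) * volume.real (Metric.ball (0 : Euc d) 1) * Real.exp (-U m / ε)
        * ε ^ ((d : ℝ) / 2)
      = ∫ x in Metric.closedBall m √ε, Real.exp (-U m / ε - |K|) := by
        rw [setIntegral_const, Measure.addHaar_real_closedBall _ _ (Real.sqrt_nonneg _),
          finrank_euclideanSpace_fin, hsqrt, smul_eq_mul, sub_eq_add_neg, Real.exp_add]
        ring
    _ ≤ ∫ x in Metric.closedBall m √ε, Real.exp (-U x / ε) := by
        refine setIntegral_mono_on (integrableOn_const measure_closedBall_lt_top.ne)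
          hZ.integrableOn measurableSet_closedBall fun x hx => ?_
        rw [Metric.mem_closedBall, dist_eq_norm] at hx
        have hx2 : ‖x - m‖ ^ 2 ≤ ε := by
          rw [← Real.sq_sqrt hε0.le]
          gcongr
        have hKx : K * ‖x - m‖ ^ 2 ≤ |K| * ε :=
          mul_le_mul (le_abs_self K) hx2 (by positivity) (abs_nonneg K)
        rw [Real.exp_le_exp, le_div_iff₀ hε0, sub_mul, div_mul_cancel₀ _ hε0.ne']
        linarith [hK x (hx.trans_lt hεr)]
    _ ≤ ∫ x, Real.exp (-U x / ε) :=
        setIntegral_le_integral hZ (Eventually.of_forall fun x => (Real.exp_pos _).le)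

/-- The Gibbs measure of a measurable set as a quotient of integrals. -/
lemma toReal_gibbs_apply {d : ℕ} {U : Euc d → ℝ} {ε : ℝ}
    (hint : Integrable fun x => Real.exp (-U x / ε)) {S : Set (Euc d)} (hS : MeasurableSet S) :
    (gibbs U ε S).toReal =
      (∫ x in S, Real.exp (-U x / ε)) / ∫ x, Real.exp (-U x / ε) := by
  rw [gibbs, Measure.smul_apply, withDensity_apply _ hS, smul_eq_mul, ENNReal.toReal_mul,
    ENNReal.toReal_inv, ENNReal.toReal_ofReal (integral_nonneg fun x => (Real.exp_pos _).le),
    integral_eq_lintegral_of_nonneg_ae (μ := volume.restrict S)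
      (Eventually.of_forall fun x => (Real.exp_pos _).le) hint.integrableOn.aestronglyMeasurable]
  exact inv_mul_eq_div _ _

/-- display (7.5) of the paper: Gibbs measure of the superlevel set
`{U ≥ H + J²ε log(1/ε)}` is bounded by `C e^{-(H-h)/ε} ε^{J² - d/2}`. -/
theorem gibbs_superlevel_bound {d : ℕ} (U : Euc d → ℝ)
    (hU : ContDiff ℝ 2 U) (hMorse : IsMorse U) (hGrowth : GrowthConditions U)
    (h : ℝ) (hmin : IsLeast (Set.range U) h)
    (H : ℝ) (hH : h < H) :
    ∀ J : ℝ, 0 < J → ∃ C > (0 : ℝ), ∃ ε₀ > (0 : ℝ), ∀ ε ∈ Set.Ioo (0 : ℝ) ε₀,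
      ((gibbs U ε) {x : Euc d | H + J ^ 2 * (ε * Real.log (1 / ε)) ≤ U x}).toReal
        ≤ C * Real.exp (-(H - h) / ε) * ε ^ (J ^ 2 - (d : ℝ) / 2) := by
  intro J hJ
  have hle : ∀ x, h ≤ U x := fun x => hmin.2 ⟨x, rfl⟩
  obtain ⟨m, rfl⟩ := hmin.1
  obtain ⟨M, hM⟩ := exists_norm_sub_le_of_growth hle hGrowth.1
  have hint := integrable_exp_neg_of_norm_le hU.continuous hM
  obtain ⟨c, hc, ε₀, hε₀, hZ⟩ := exists_partition_lower_bound hU hle hint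
  have hI : 0 < ∫ x, Real.exp (-U x) := integral_exp_pos hint
  set I := ∫ x, Real.exp (-U x)
  refine ⟨Real.exp (H + J ^ 2) * I / c, by positivity, min 1 ε₀, by positivity, fun ε hε => ?_⟩
  have hε0 := hε.1
  have hε1 : ε ≤ 1 := (hε.2.trans_le (min_le_left _ _)).le
  have hZε := hZ ε ⟨hε0, hε.2.trans_le (min_le_right _ _)⟩
  have hlog : ε * Real.log (1 / ε) ≤ 1 := by
    have h1 : Real.log (1 / ε) ≤ 1 / ε := Real.log_le_self (by positivity)
    calc ε * Real.log (1 / ε) ≤ ε * (1 / ε) := by gcongr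
      _ = 1 := mul_one_div_cancel hε0.ne'
  set a := H + J ^ 2 * (ε * Real.log (1 / ε)) with ha
  have haH : a ≤ H + J ^ 2 := by nlinarith [sq_nonneg J]
  have hexp : Real.exp (-a / ε) = Real.exp (-H / ε) * ε ^ (J ^ 2) := by
    rw [Real.rpow_def_of_pos hε0, ← Real.exp_add, ha, one_div, Real.log_inv]
    congr 1
    field_simp
    ring
  have hnum := setIntegral_superlevel_le hU.continuous hle hint a hε0 hε1
  have hpos : 0 < c * Real.exp (-U m / ε) * ε ^ ((d : ℝ) / 2) := by positivity
  rw [toReal_gibbs_apply (integrable_exp_neg_div hU.continuous hle hint hε0 hε1)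
    (measurableSet_le measurable_const hU.continuous.measurable)]
  calc (∫ x in {x | a ≤ U x}, Real.exp (-U x / ε)) / ∫ x, Real.exp (-U x / ε)
      ≤ (Real.exp (-a / ε) * (Real.exp (H + J ^ 2) * I)) /
          (c * Real.exp (-U m / ε) * ε ^ ((d : ℝ) / 2)) := by
        refine div_le_div₀ (by positivity) (hnum.trans ?_) hpos hZε
        gcongr
    _ = _ := by
        have hsplit : Real.exp (-(H - U m) / ε) = Real.exp (-H / ε) / Real.exp (-U m / ε) := by
          rw [← Real.exp_sub]
          ring_nf
        rw [hexp, Real.rpow_sub hε0, hsplit]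
        field_simp
end
end
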